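/- Let d ≥ 2, r ∈ ℤ, ω = exp(2πi/d), c(m) = exp(π·i·m·(m+2r+d)/d), and č_0 = (1/√d)·∑_{m=0}^{d−1} c(m). Let X and Z be the d×d generalized Pauli matrices indexed by ZMod d (Z_{k,l} = ω^k·δ_{k,l}, X_{k,l} = 1 iff k = l+1), and let A be the diagonal matrix with A_{k,k} = č_0·conj(c(k)) (lifting k ∈ ZMod d to {0,…,d−1}). Then A commutes with Z, and A·X·A^† = exp(−π·i·(2r+d+1)/d)·X·Z^†, where † is the conjugate transpose. -/

import Mathlib

open Complex Matrix

variable (d : ℕ) [NeZero d]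

/-- ω = exp(2πi/d). -/
noncomputable def omegaC : ℂ := Complex.exp (2 * Real.pi * Complex.I / d)

/-- The Frank–Zadoff–Chu sequence `c(m) = exp(π i m (m+2r+d)/d)`. -/
noncomputable def fzc (r m : ℤ) : ℂ :=
  Complex.exp (Real.pi * Complex.I * m * (m + 2 * r + d) / d)

/-- `č₀ = (1/√d) ∑_{m=0}^{d-1} c(m)`. -/
noncomputable def c0check (r : ℤ) : ℂ :=
  ((Real.sqrt d : ℂ))⁻¹ * ∑ m ∈ Finset.range d, fzc d r m

/-- The generalized Pauli `Z`: `Z_{k,l} = ω^k δ_{k,l}`. -/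
noncomputable def Zp : Matrix (ZMod d) (ZMod d) ℂ :=
  fun k l => if k = l then omegaC d ^ k.val else 0

/-- The generalized Pauli `X`: `X_{k,l} = 1` iff `k = l + 1`. -/
def Xp : Matrix (ZMod d) (ZMod d) ℂ :=
  fun k l => if k = l + 1 then 1 else 0

/-- The diagonal braid-gate matrix `A` with `A_{k,k} = č₀ · conj (c k)`. -/
noncomputable def Amat (r : ℤ) : Matrix (ZMod d) (ZMod d) ℂ :=
  fun k l => if k = l then c0check d r * (starRingEnd ℂ) (fzc d r k.val) else 0

lemma fzc_add_aux (r m n : ℤ) :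
    fzc d r (m + n) = fzc d r m * fzc d r n * ZMod.stdAddChar (N := d) ((m * n : ℤ) : ZMod d) := by
  have hd0 : (d : ℂ) ≠ 0 := Nat.cast_ne_zero.mpr (NeZero.ne d)
  rw [ZMod.stdAddChar_coe, fzc, fzc, fzc, ← Complex.exp_add, ← Complex.exp_add]
  congr 1
  push_cast
  field_simp
  ring

lemma fzc_mul_d_aux (r k : ℤ) : fzc d r (d * k) = 1 := by
  have hd0 : (d : ℂ) ≠ 0 := Nat.cast_ne_zero.mpr (NeZero.ne d)
  obtain ⟨t, ht⟩ : Even (k * (d * k + d)) := by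
    have : k * (d * k + d) = d * (k * (k + 1)) := by ring
    rw [this]
    exact (Int.even_mul_succ_self k).mul_left _
  have htC : (k : ℂ) * (d * k + d) = t + t := by exact_mod_cast ht
  rw [fzc, Complex.exp_eq_one_iff]
  refine ⟨t + k * r, ?_⟩
  push_cast
  field_simp
  linear_combination htC

/-- The sequence on `ZMod d`. -/
noncomputable def fzcZ (r : ℤ) (a : ZMod d) : ℂ := fzc d r a.val

lemma fzcZ_coe (r m : ℤ) : fzcZ d r (m : ZMod d) = fzc d r m := by
  have h : ((m - (m : ZMod d).val : ℤ) : ZMod d) = 0 := by simp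
  rw [ZMod.intCast_zmod_eq_zero_iff_dvd] at h
  obtain ⟨k, hk⟩ := h
  have hm : m = (m : ZMod d).val + d * k := by linarith
  conv_rhs => rw [hm]
  rw [fzc_add_aux, fzc_mul_d_aux]
  simp [fzcZ]

lemma fzcZ_add (r : ℤ) (a b : ZMod d) :
    fzcZ d r (a + b) = fzcZ d r a * fzcZ d r b * ZMod.stdAddChar (a * b) := by
  obtain ⟨m, rfl⟩ := ZMod.intCast_surjective a
  obtain ⟨n, rfl⟩ := ZMod.intCast_surjective b
  rw [← Int.cast_add, ← Int.cast_mul, fzcZ_coe, fzcZ_coe, fzcZ_coe, fzc_add_aux]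

lemma fzcZ_conj (r : ℤ) (a : ZMod d) : (starRingEnd ℂ) (fzcZ d r a) * fzcZ d r a = 1 := by
  rw [fzcZ, fzc, ← Complex.exp_conj, ← Complex.exp_add, ← Complex.exp_zero]
  congr 1
  generalize (a.val : ℤ) = m
  have h2 : (starRingEnd ℂ) 2 = 2 := Complex.conj_ofNat 2
  simp [h2]
  ring

lemma sum_fzc_eq (r : ℤ) : ∑ m ∈ Finset.range d, fzc d r m = ∑ a : ZMod d, fzcZ d r a := by
  refine Finset.sum_bij' (fun m _ => (m : ZMod d)) (fun a _ => a.val) ?_ ?_ ?_ ?_ ?_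
  · simp
  · intro a _
    simpa using ZMod.val_lt a
  · intro m hm
    exact ZMod.val_cast_of_lt (by simpa using hm)
  · simp
  · intro m _
    have := fzcZ_coe d r m
    simpa using this.symm

lemma gauss_norm (r : ℤ) :
    (∑ a : ZMod d, fzcZ d r a) * (starRingEnd ℂ) (∑ a : ZMod d, fzcZ d r a) = d := by
  have h1 : ∀ b : ZMod d, (∑ a : ZMod d, fzcZ d r a) * (starRingEnd ℂ) (fzcZ d r b)
      = ∑ a : ZMod d, fzcZ d r a * ZMod.stdAddChar (b * a) := by
    intro b
    rw [← Equiv.sum_comp (Equiv.addLeft b) (fzcZ d r), Finset.sum_mul]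
    refine Finset.sum_congr rfl fun a _ => ?_
    rw [Equiv.coe_addLeft, fzcZ_add]
    linear_combination (fzcZ d r a * ZMod.stdAddChar (b * a)) * fzcZ_conj d r b
  rw [map_sum, Finset.mul_sum, Finset.sum_congr rfl fun b _ => h1 b, Finset.sum_comm]
  simp_rw [← Finset.mul_sum, AddChar.sum_mulShift _ (ZMod.isPrimitive_stdAddChar d)]
  simp [ZMod.card, fzcZ, fzc]

lemma c0_norm (r : ℤ) : c0check d r * (starRingEnd ℂ) (c0check d r) = 1 := by
  have hd0 : (d : ℂ) ≠ 0 := Nat.cast_ne_zero.mpr (NeZero.ne d)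
  have hs : ((Real.sqrt d : ℝ) : ℂ) * (Real.sqrt d : ℝ) = d := by
    rw [← Complex.ofReal_mul, Real.mul_self_sqrt (Nat.cast_nonneg d)]
    simp
  have hg := gauss_norm d r
  rw [c0check, sum_fzc_eq, map_mul, map_inv₀, Complex.conj_ofReal, mul_mul_mul_comm, hg,
    ← mul_inv, hs, inv_mul_cancel₀ hd0]

lemma omega_pow (a : ZMod d) : omegaC d ^ a.val = ZMod.stdAddChar a := by
  have h := ZMod.stdAddChar_coe (N := d) (a.val : ℤ)
  rw [omegaC, ← Complex.exp_nat_mul]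
  rw [Int.cast_natCast, Int.cast_natCast, ZMod.natCast_zmod_val] at h
  rw [h]
  congr 1
  ring

lemma fzcZ_one_conj (r : ℤ) : (starRingEnd ℂ) (fzcZ d r 1) =
    Complex.exp (-(Real.pi * Complex.I * (2 * r + d + 1)) / d) := by
  have h := fzcZ_coe d r 1
  rw [Int.cast_one] at h
  rw [h, fzc, ← Complex.exp_conj]
  congr 1
  have h2 : (starRingEnd ℂ) 2 = 2 := Complex.conj_ofNat 2
  simp [h2]
  ring

lemma Amat_eq (r : ℤ) : Amat d r =
    Matrix.diagonal fun k => c0check d r * (starRingEnd ℂ) (fzcZ d r k) := by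
  ext k l
  simp [Amat, Matrix.diagonal_apply, fzcZ]

lemma Zp_eq : Zp d = Matrix.diagonal fun k => (ZMod.stdAddChar k : ℂ) := by
  ext k l
  simp [Zp, Matrix.diagonal_apply, omega_pow]

/-- for `d ≥ 2` and `r : ℤ`, the braid gate `A` commutes with `Z`, and
`A X Aᴴ = exp(-π i (2r+d+1)/d) · X Zᴴ`. -/
theorem statement13 (hd : 2 ≤ d) (r : ℤ) :
    Amat d r * Zp d = Zp d * Amat d r ∧
    Amat d r * Xp d * (Amat d r)ᴴ =
      Complex.exp (-(Real.pi * Complex.I * (2 * r + d + 1)) / d) • (Xp d * (Zp d)ᴴ) := by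
  rw [Amat_eq, Zp_eq]
  constructor
  · rw [Matrix.diagonal_mul_diagonal, Matrix.diagonal_mul_diagonal]
    simp_rw [mul_comm]
  · rw [Matrix.diagonal_conjTranspose, Matrix.diagonal_conjTranspose, ← fzcZ_one_conj]
    ext k l
    rw [Matrix.mul_diagonal, Matrix.diagonal_mul, Matrix.smul_apply, Matrix.mul_diagonal, Xp]
    by_cases h : k = l + 1
    · subst h
      simp only [if_true, Pi.star_apply, smul_eq_mul, fzcZ_add, mul_one, one_mul, map_mul,
        star_mul', RCLike.star_def, Complex.conj_conj]
      linear_combination (starRingEnd ℂ (fzcZ d r 1) * starRingEnd ℂ (ZMod.stdAddChar l)) *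
        (fzcZ_conj d r l * c0check d r * starRingEnd ℂ (c0check d r) + c0_norm d r)
    · simp [h]
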